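/- arXiv:1603.03717 — 2 statements merged into one kernel-verified Lean document; each statement's English description precedes it below -/
import Mathlib

section
/- For any complex linear operator L and any integer k > 1, if tr((L†L)^k) ≠ 0, then rank(L)^(k-1) ≥ (tr(L†L))^k / tr((L†L)^k). -/
open Matrix

theorem stmt_0_aux {n : ℕ} {A : Matrix (Fin n) (Fin n) ℂ} (hA : A.IsHermitian) (k : ℕ) :
    (A ^ k).trace = ((∑ i, hA.eigenvalues i ^ k : ℝ) : ℂ) := by
  conv_lhs => rw [hA.spectral_theorem]
  rw [← map_pow, Matrix.diagonal_pow, Unitary.conjStarAlgAut_apply, Matrix.trace_mul_cycle]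
  simp [Matrix.trace_diagonal]

open scoped ComplexOrder

/-- For any complex linear operator `L` and any integer `k > 1`, if
`tr((L†L)^k) ≠ 0` then `rank(L)^(k-1) ≥ (tr(L†L))^k / tr((L†L)^k)`. -/
theorem stmt_0 {m n : ℕ} (L : Matrix (Fin m) (Fin n) ℂ) (k : ℕ) (hk : 1 < k)
    (h : ((Lᴴ * L) ^ k).trace ≠ 0) :
    (L.rank : ℝ) ^ (k - 1) ≥ ((Lᴴ * L).trace.re) ^ k / ((Lᴴ * L) ^ k).trace.re := by
  have hP := Matrix.posSemidef_conjTranspose_mul_self L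
  have hA := hP.isHermitian
  have hn := hP.eigenvalues_nonneg
  have hr := hA.rank_eq_card_non_zero_eigs
  rw [Matrix.rank_conjTranspose_mul_self, Fintype.card_subtype] at hr
  have h1 := stmt_0_aux hA 1
  have h2 := stmt_0_aux hA k
  rw [h2] at h
  have hne : (∑ i, hA.eigenvalues i ^ k) ≠ 0 := by exact_mod_cast h
  have hpos : 0 < ∑ i, hA.eigenvalues i ^ k :=
    lt_of_le_of_ne (Finset.sum_nonneg fun i _ => pow_nonneg (hn i) k) hne.symm
  simp only [pow_one] at h1
  rw [h1, h2, Complex.ofReal_re, Complex.ofReal_re, ge_iff_le, div_le_iff₀ hpos, hr]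
  obtain ⟨j, rfl⟩ : ∃ j, k = j + 1 := ⟨k - 1, by omega⟩
  have e : ∀ p : ℕ, p ≠ 0 → ∑ i, hA.eigenvalues i ^ p =
      ∑ i with hA.eigenvalues i ≠ 0, hA.eigenvalues i ^ p := by
    intro p hp
    symm
    apply Finset.sum_filter_of_ne
    intro i _ hi h0
    exact hi (by rw [h0, zero_pow hp])
  have e1 := e 1 one_ne_zero
  simp only [pow_one] at e1
  rw [e1, e (j + 1) (by omega), Nat.add_sub_cancel]
  exact pow_sum_le_card_mul_sum_pow (fun i _ => hn i) j
end

section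
/- Let L be a random matrix (a measurable matrix-valued function on a probability space) such that E[tr(L†L)^k] and E[tr((L†L)^k)] exist and are nonzero for some integer k > 1. Then there exists a point in the sample space at which the matrix L₀ satisfies rank(L₀)^(k-1) ≥ E[tr(L†L)]^k / E[tr((L†L)^k)]. -/
open Matrix MeasureTheory

lemma trace_pow_re_eq {n : ℕ} (A : Matrix (Fin n) (Fin n) ℂ) (hA : A.IsHermitian) (k : ℕ) :
    (A ^ k).trace.re = ∑ i, hA.eigenvalues i ^ k := by
  have h : (A ^ k).trace = ∑ i, ((hA.eigenvalues i : ℂ)) ^ k := by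
    conv_lhs => rw [hA.spectral_theorem, ← map_pow, Unitary.conjStarAlgAut_apply, trace_mul_comm,
      ← mul_assoc]
    simp [diagonal_pow, trace_diagonal]
  rw [h, Complex.re_sum]
  refine Finset.sum_congr rfl fun i _ => ?_
  rw [← Complex.ofReal_pow, Complex.ofReal_re]

open scoped ComplexOrder in
lemma trace_nonneg_aux {m n : ℕ} (L : Matrix (Fin m) (Fin n) ℂ) (k : ℕ) :
    0 ≤ ((Lᴴ * L) ^ k).trace.re := by
  have hp := posSemidef_conjTranspose_mul_self L
  rw [trace_pow_re_eq _ hp.1]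
  exact Finset.sum_nonneg fun i _ => pow_nonneg (hp.eigenvalues_nonneg i) k

open scoped ComplexOrder in
lemma pointwise_aux {m n : ℕ} (L : Matrix (Fin m) (Fin n) ℂ) (k : ℕ) :
    (Lᴴ * L).trace.re ^ (k + 1) ≤ (L.rank : ℝ) ^ k * ((Lᴴ * L) ^ (k + 1)).trace.re := by
  have hp := posSemidef_conjTranspose_mul_self L
  have h1 := trace_pow_re_eq _ hp.1 1
  simp only [pow_one] at h1
  rw [trace_pow_re_eq _ hp.1, h1, ← rank_conjTranspose_mul_self L,
    hp.1.rank_eq_card_non_zero_eigs, Fintype.card_subtype]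
  set f := hp.1.eigenvalues with hf
  set s := Finset.univ.filter (fun i => f i ≠ 0) with hs
  have e1 : ∑ i, f i = ∑ i ∈ s, f i := (Finset.sum_filter_ne_zero _).symm
  have e2 : ∑ i, f i ^ (k + 1) = ∑ i ∈ s, f i ^ (k + 1) := by
    symm
    apply Finset.sum_subset (Finset.subset_univ _)
    intro i _ hi
    have : f i = 0 := by simpa [hs] using hi
    simp [this]
  rw [e1, e2]
  rcases s.eq_empty_or_nonempty with h | h
  · simp [h]
  · have := pow_sum_div_card_le_sum_pow (s := s) (f := f)
      (fun i _ => hp.eigenvalues_nonneg i) k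
    have hc : (0 : ℝ) < s.card := by exact_mod_cast h.card_pos
    rwa [div_le_iff₀' (by positivity)] at this

/-- For a random complex matrix `L` with `E[tr(L†L)^k]` and `E[tr((L†L)^k)]` existing and
nonzero (`k > 1`), there is a sample point `ω` with
`rank(L ω)^(k-1) ≥ E[tr(L†L)]^k / E[tr((L†L)^k)]`. -/
theorem stmt_8 {Ω : Type*} [MeasurableSpace Ω] (μ : MeasureTheory.Measure Ω)
    [IsProbabilityMeasure μ] {m n : ℕ} (L : Ω → Matrix (Fin m) (Fin n) ℂ)
    (hmeas : ∀ i j, Measurable fun ω => L ω i j) (k : ℕ) (hk : 1 < k)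
    (hint1 : Integrable (fun ω => ((L ω)ᴴ * L ω).trace.re) μ)
    (hint1k : Integrable (fun ω => (((L ω)ᴴ * L ω).trace.re) ^ k) μ)
    (hint2 : Integrable (fun ω => (((L ω)ᴴ * L ω) ^ k).trace.re) μ)
    (hne1 : ∫ ω, (((L ω)ᴴ * L ω).trace.re) ^ k ∂μ ≠ 0)
    (hne2 : ∫ ω, (((L ω)ᴴ * L ω) ^ k).trace.re ∂μ ≠ 0) :
    ∃ ω : Ω, ((L ω).rank : ℝ) ^ (k - 1) ≥
      (∫ ω, ((L ω)ᴴ * L ω).trace.re ∂μ) ^ k / ∫ ω, (((L ω)ᴴ * L ω) ^ k).trace.re ∂μ := by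
  obtain ⟨j, rfl⟩ : ∃ j, k = j + 1 := ⟨k - 1, by omega⟩
  have hne : Nonempty Ω := by
    by_contra h
    rw [not_nonempty_iff] at h
    exact IsProbabilityMeasure.ne_zero μ (Measure.eq_zero_of_isEmpty μ)
  have hfin : (Set.range fun ω => (L ω).rank).Finite :=
    (Set.finite_Iic n).subset (by
      rintro _ ⟨ω, rfl⟩
      simpa using (L ω).rank_le_width)
  obtain ⟨_, ⟨ω₀, rfl⟩, hmax⟩ :=
    Set.exists_max_image _ id hfin (Set.range_nonempty _)
  refine ⟨ω₀, ?_⟩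
  have hpos : 0 < ∫ ω, (((L ω)ᴴ * L ω) ^ (j + 1)).trace.re ∂μ :=
    lt_of_le_of_ne (integral_nonneg fun ω => trace_nonneg_aux (L ω) _) (Ne.symm hne2)
  rw [ge_iff_le, div_le_iff₀ hpos, Nat.add_sub_cancel]
  calc (∫ ω, ((L ω)ᴴ * L ω).trace.re ∂μ) ^ (j + 1)
      ≤ ∫ ω, (((L ω)ᴴ * L ω).trace.re) ^ (j + 1) ∂μ :=
        (convexOn_pow (j + 1)).map_integral_le (continuousOn_pow _) isClosed_Ici
          (Filter.Eventually.of_forall fun ω => by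
            simpa using trace_nonneg_aux (L ω) 1) hint1 hint1k
    _ ≤ ∫ ω, ((L ω₀).rank : ℝ) ^ j * (((L ω)ᴴ * L ω) ^ (j + 1)).trace.re ∂μ := by
        refine integral_mono hint1k (hint2.const_mul _) fun ω => ?_
        refine (pointwise_aux (L ω) j).trans ?_
        refine mul_le_mul_of_nonneg_right ?_ (trace_nonneg_aux (L ω) _)
        have : (L ω).rank ≤ (L ω₀).rank := hmax _ ⟨ω, rfl⟩
        gcongr
    _ = _ := integral_const_mul _ _
end
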